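/- arXiv:2408.10456 — 2 statements merged into one kernel-verified Lean document; each statement's English description precedes it below -/
import Mathlib

section
/- Let r > 0, s > 0, and set σ = 2s/r. Let β₁, β₂ > 0 be reals with β₁ + β₂ an integer, and let u, v ∈ ℝ^p satisfy ‖u‖ ≤ r and ‖v‖ ≤ r. Then ∫_{ℝ^p} |N_{u,s²}(θ)/N_{0,s²}(θ) − 1|^{β₁} · |N_{v,s²}(θ)/N_{0,s²}(θ) − 1|^{β₂} · N_{0,s²}(θ) dθ ≤ B̃_{σ,β₁+β₂}. -/
open MeasureTheory Finset

noncomputable section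

/-- `p`-dimensional Gaussian density with mean `μ` and covariance `s² I`. -/
def gaussND {p : ℕ} (μ : EuclideanSpace ℝ (Fin p)) (s : ℝ)
    (x : EuclideanSpace ℝ (Fin p)) : ℝ :=
  (2 * Real.pi * s ^ 2) ^ (-(p : ℝ) / 2) * Real.exp (-‖x - μ‖ ^ 2 / (2 * s ^ 2))

/-- one-dimensional Gaussian density with mean `μ` and variance `s²`. -/
def gauss1 (μ s θ : ℝ) : ℝ :=
  (2 * Real.pi * s ^ 2) ^ (-(1 : ℝ) / 2) * Real.exp (-(θ - μ) ^ 2 / (2 * s ^ 2))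

/-- Rényi divergence of order `α` between densities `P` and `Q` w.r.t. the measure `ν`. -/
def renyiDiv {Ω : Type*} [MeasurableSpace Ω] (ν : Measure Ω) (α : ℝ) (P Q : Ω → ℝ) : ℝ :=
  (α - 1)⁻¹ * Real.log (∫ x, (P x / Q x) ^ α * Q x ∂ν)

/-- `M_{σ,k} = ∫ (N_{1,σ²/4}/N_{0,σ²/4} − 1)^k N_{0,σ²/4}`. -/
def Mcoef (σ : ℝ) (k : ℕ) : ℝ :=
  ∫ θ : ℝ, (gauss1 1 (σ / 2) θ / gauss1 0 (σ / 2) θ - 1) ^ k * gauss1 0 (σ / 2) θ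

/-- `B̃_{σ,j}`. -/
def Btil (σ : ℝ) (j : ℕ) : ℝ :=
  if Even j then Mcoef σ j else Real.sqrt (Mcoef σ (j - 1) * Mcoef σ (j + 1))

/-- `H_{α,σ}(q)`. -/
def Hfun (α σ q : ℝ) : ℝ :=
  ∫ θ : ℝ, (q * (gauss1 1 (σ / 2) θ / gauss1 0 (σ / 2) θ) + (1 - q)) ^ α * gauss1 0 (σ / 2) θ

/-- `R̃_{α,σ,3}(q)`. -/
def Rtil3 (α σ q : ℝ) : ℝ :=
  if 3 < α then
    q ^ 3 * α * (α - 1) * |α - 2| *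
      ((∑ ℓ ∈ Finset.range (⌈α⌉₊ - 3 + 1),
          q ^ ℓ * ((⌈α⌉₊ - 3).factorial : ℝ) /
            (((⌈α⌉₊ - 3 - ℓ).factorial : ℝ) * ((3 + ℓ).factorial : ℝ)) * Btil σ (ℓ + 3)) +
        1 / 6 * Btil σ 3)
  else
    q ^ 3 * α * (α - 1) * |α - 2| * (1 / 6 * (1 - q) ^ (α - 3) * Btil σ 3)

/-- `F̃_{α,σ,k}`. -/
def Ftil (α σ : ℝ) (k : ℕ) : ℝ :=
  (α - 1) * α ^ (k - 1) *
      (if Even k then 4 * Mcoef σ k else 3 * Real.sqrt (Mcoef σ (k - 1) * Mcoef σ (k + 1))) +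
    (α - 1) * α ^ (k - 1) *
      ∑ j ∈ Finset.range (k + 1),
        (k.choose j : ℝ) *
          |α / (α - 1) * (∏ ℓ ∈ Finset.range j, (1 - (ℓ : ℝ) / α)) *
              (∏ ℓ ∈ Finset.range (k - j), (1 + ((ℓ : ℝ) - 1) / α)) - 1| *
          Btil σ k

/-- `Ẽ_{α,σ,m}(q)`. -/
def Etil (α σ : ℝ) (m : ℕ) (q : ℝ) : ℝ :=
  (q ^ m / (m.factorial : ℝ)) *
    ∑ j ∈ Finset.range (m + 1),
      (1 - q) ^ (-(α + (m : ℝ) - (j : ℝ) - 1)) * (m.choose j : ℝ) *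
        (∏ ℓ ∈ Finset.range j, |α - (ℓ : ℝ)|) *
        (∏ ℓ ∈ Finset.range (m - j), (α + (ℓ : ℝ) - 1)) *
        (if α ≤ (j : ℝ) then (1 - q) ^ (α - (j : ℝ)) * Btil σ m
         else Btil σ m + ∑ ℓ ∈ Finset.range (⌈α⌉₊ - j + 1),
           q ^ ℓ * ((⌈α⌉₊ - j).factorial : ℝ) * (m.factorial : ℝ) /
             (((⌈α⌉₊ - j - ℓ).factorial : ℝ) * ((m + ℓ).factorial : ℝ)) * Btil σ (ℓ + m))

/-- A sequence all of whose iterated forward differences are nonnegative. -/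
def AbsMonotoneSeq (f : ℕ → ℝ) : Prop :=
  ∀ i n : ℕ, 0 ≤ (fwdDiff 1)^[i] f n

namespace AbsMonotoneSeq

variable {f g : ℕ → ℝ}

lemma forwardDiff (hf : AbsMonotoneSeq f) : AbsMonotoneSeq (fwdDiff 1 f) := fun i n => by
  simpa only [← Function.iterate_succ_apply] using hf (i + 1) n

lemma add (hf : AbsMonotoneSeq f) (hg : AbsMonotoneSeq g) : AbsMonotoneSeq (f + g) :=
  fun i n => by
    rw [fwdDiff_iter_add]
    exact add_nonneg (hf i n) (hg i n)

lemma shift (hf : AbsMonotoneSeq f) : AbsMonotoneSeq (fun n => f (n + 1)) := by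
  have h : (fun n => f (n + 1)) = f + fwdDiff 1 f := by
    ext n
    simp [fwdDiff]
  rw [h]
  exact hf.add hf.forwardDiff

lemma mul (hf : AbsMonotoneSeq f) (hg : AbsMonotoneSeq g) : AbsMonotoneSeq (f * g) := by
  intro i
  induction i generalizing f g with
  | zero =>
    intro n
    exact mul_nonneg (hf 0 n) (hg 0 n)
  | succ i ih =>
    intro n
    have h : fwdDiff 1 (f * g) =
        (fun n => f (n + 1)) * fwdDiff 1 g + fwdDiff 1 f * g := by
      ext n
      simp only [fwdDiff, Pi.mul_apply, Pi.add_apply]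
      ring
    rw [Function.iterate_succ_apply, h, fwdDiff_iter_add]
    exact add_nonneg (ih hf.shift hg.forwardDiff n) (ih hf.forwardDiff hg n)

lemma const {c : ℝ} (hc : 0 ≤ c) : AbsMonotoneSeq (fun _ => c) := by
  intro i n
  induction i generalizing c with
  | zero => exact hc
  | succ i ih =>
    rw [Function.iterate_succ_apply, fwdDiff_const]
    exact ih le_rfl

lemma pow (hf : AbsMonotoneSeq f) (m : ℕ) : AbsMonotoneSeq (f ^ m) := by
  induction m with
  | zero => exact const zero_le_one
  | succ m ih =>
    rw [pow_succ]
    exact ih.mul hf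

lemma hasSum {F : ℕ → ℕ → ℝ} (hF : ∀ m, AbsMonotoneSeq (F m))
    (h : ∀ n, HasSum (fun m => F m n) (f n)) : AbsMonotoneSeq f := by
  intro i n
  have key : HasSum (fun m => (fwdDiff 1)^[i] (F m) n) ((fwdDiff 1)^[i] f n) := by
    simp only [fwdDiff_iter_eq_sum_shift]
    exact hasSum_sum fun k _ => (h _).const_smul _
  exact key.nonneg fun m => hF m i n

lemma choose_two : AbsMonotoneSeq (fun n => (n.choose 2 : ℝ)) := by
  have h (j : ℕ) : AbsMonotoneSeq (fun n => (n.choose j : ℝ)) := by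
    intro i n
    induction i generalizing j with
    | zero => simp
    | succ i ih =>
      rw [Function.iterate_succ_apply]
      cases j with
      | zero =>
        have h0 : fwdDiff 1 (fun n : ℕ => (n.choose 0 : ℝ)) = fun _ => 0 := by
          ext m
          simp [fwdDiff]
        rw [h0]
        exact const le_rfl i n
      | succ j =>
        have h1 : fwdDiff 1 (fun n : ℕ => (n.choose (j + 1) : ℝ)) =
            fun n => (n.choose j : ℝ) := by
          ext m
          simp [fwdDiff, Nat.choose_succ_succ]
        rw [h1]
        exact ih j
  exact h 2

lemma exp_sub_one (hf : AbsMonotoneSeq f) : AbsMonotoneSeq (fun n => Real.exp (f n) - 1) := by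
  refine hasSum (F := fun m n => (1 / ((m + 1).factorial : ℝ)) * f n ^ (m + 1))
    (fun m => (const (by positivity)).mul (hf.pow (m + 1))) fun n => ?_
  have h := NormedSpace.expSeries_div_hasSum_exp (f n)
  rw [← Real.exp_eq_exp_ℝ, ← hasSum_nat_add_iff' 1] at h
  simpa [div_eq_inv_mul] using h

lemma exp (hf : AbsMonotoneSeq f) : AbsMonotoneSeq (fun n => Real.exp (f n)) := by
  have h := hf.exp_sub_one.add (const zero_le_one)
  convert h using 1
  ext n
  simp

end AbsMonotoneSeq

/-- The `k`-th centred moment of the likelihood ratio of two Gaussians whose means are at squared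
Mahalanobis distance `w`. -/
def likelihoodMoment (w : ℝ) (k : ℕ) : ℝ :=
  (fwdDiff 1)^[k] (fun n : ℕ => Real.exp (w * (n.choose 2 : ℝ))) 0

lemma likelihoodMoment_mono {w w' : ℝ} (hw : 0 ≤ w) (h : w ≤ w') (k : ℕ) :
    likelihoodMoment w k ≤ likelihoodMoment w' k := by
  have hd : AbsMonotoneSeq (fun n : ℕ => Real.exp (w * (n.choose 2 : ℝ)) *
      (Real.exp ((w' - w) * (n.choose 2 : ℝ)) - 1)) :=
    ((AbsMonotoneSeq.const hw).mul AbsMonotoneSeq.choose_two).exp.mul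
      ((AbsMonotoneSeq.const (sub_nonneg.2 h)).mul AbsMonotoneSeq.choose_two).exp_sub_one
  have hs : (fun n : ℕ => Real.exp (w' * (n.choose 2 : ℝ))) =
      (fun n : ℕ => Real.exp (w * (n.choose 2 : ℝ))) +
      fun n : ℕ => Real.exp (w * (n.choose 2 : ℝ)) *
        (Real.exp ((w' - w) * (n.choose 2 : ℝ)) - 1) := by
    ext n
    simp only [Pi.add_apply, mul_sub, ← Real.exp_add]
    ring_nf
  unfold likelihoodMoment
  rw [hs, fwdDiff_iter_add]
  exact le_add_of_nonneg_right (hd k 0)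

section Gaussian

variable {V : Type*} [NormedAddCommGroup V] [InnerProductSpace ℝ V]

/-- Gaussian density with mean `μ` and covariance `s² I` on a Euclidean space. -/
def gaussDensity (μ : V) (s : ℝ) (x : V) : ℝ :=
  (2 * Real.pi * s ^ 2) ^ (-(Module.finrank ℝ V : ℝ) / 2) *
    Real.exp (-‖x - μ‖ ^ 2 / (2 * s ^ 2))

lemma gaussDensity_pos {s : ℝ} (hs : 0 < s) (μ x : V) : 0 < gaussDensity μ s x := by
  unfold gaussDensity
  positivity

lemma likelihood_pow_mul_gaussDensity {s : ℝ} (hs : 0 < s) (u x : V) (j : ℕ) :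
    (gaussDensity u s x / gaussDensity 0 s x) ^ j * gaussDensity 0 s x =
      Real.exp (‖u‖ ^ 2 / s ^ 2 * (j.choose 2 : ℝ)) * gaussDensity ((j : ℝ) • u) s x := by
  have hC : (2 * Real.pi * s ^ 2) ^ (-(Module.finrank ℝ V : ℝ) / 2) ≠ 0 := by positivity
  unfold gaussDensity
  rw [mul_div_mul_left _ _ hC, ← Real.exp_sub, ← Real.exp_nat_mul, mul_left_comm,
    ← Real.exp_add, mul_left_comm, ← Real.exp_add, Nat.cast_choose_two, sub_zero,
    norm_sub_sq_real, norm_sub_sq_real, norm_smul, inner_smul_right, mul_pow, norm_natCast]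
  congr 2
  field_simp
  ring

lemma likelihood_sub_one_pow_mul_gaussDensity {s : ℝ} (hs : 0 < s) (u x : V) (k : ℕ) :
    (gaussDensity u s x / gaussDensity 0 s x - 1) ^ k * gaussDensity 0 s x =
      ∑ j ∈ range (k + 1), ((-1 : ℝ) ^ (k - j) * (k.choose j : ℝ) *
        Real.exp (‖u‖ ^ 2 / s ^ 2 * (j.choose 2 : ℝ))) * gaussDensity ((j : ℝ) • u) s x := by
  rw [sub_eq_add_neg, add_pow, sum_mul]
  refine sum_congr rfl fun j _ => ?_
  rw [mul_assoc _ (Real.exp _), ← likelihood_pow_mul_gaussDensity hs]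
  ring

variable [FiniteDimensional ℝ V] [MeasurableSpace V] [BorelSpace V]

lemma integral_gaussDensity {s : ℝ} (hs : 0 < s) (μ : V) : ∫ x, gaussDensity μ s x = 1 := by
  unfold gaussDensity
  rw [integral_const_mul,
    integral_sub_right_eq_self (fun x : V => Real.exp (-‖x‖ ^ 2 / (2 * s ^ 2))) μ]
  have h := GaussianFourier.integral_rexp_neg_mul_sq_norm (V := V)
    (b := 1 / (2 * s ^ 2)) (by positivity)
  have h2 : ∀ x : V, -‖x‖ ^ 2 / (2 * s ^ 2) = -(1 / (2 * s ^ 2)) * ‖x‖ ^ 2 := fun x => by ring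
  simp only [h2]
  rw [h, show Real.pi / (1 / (2 * s ^ 2)) = 2 * Real.pi * s ^ 2 by field_simp,
    ← Real.rpow_add (by positivity)]
  simp [neg_div]

lemma integrable_gaussDensity {s : ℝ} (hs : 0 < s) (μ : V) : Integrable (gaussDensity μ s) :=
  Integrable.of_integral_ne_zero (by rw [integral_gaussDensity hs μ]; exact one_ne_zero)

lemma integrable_likelihood_sub_one_pow {s : ℝ} (hs : 0 < s) (u : V) (k : ℕ) :
    Integrable fun x : V =>
      (gaussDensity u s x / gaussDensity 0 s x - 1) ^ k * gaussDensity 0 s x := by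
  simp only [likelihood_sub_one_pow_mul_gaussDensity hs]
  exact integrable_finsetSum _ fun j _ => (integrable_gaussDensity hs _).const_mul _

lemma integral_likelihood_sub_one_pow {s : ℝ} (hs : 0 < s) (u : V) (k : ℕ) :
    ∫ x : V, (gaussDensity u s x / gaussDensity 0 s x - 1) ^ k * gaussDensity 0 s x =
      likelihoodMoment (‖u‖ ^ 2 / s ^ 2) k := by
  simp only [likelihood_sub_one_pow_mul_gaussDensity hs]
  rw [integral_finsetSum _ fun j _ => (integrable_gaussDensity hs _).const_mul _]
  simp only [integral_const_mul, integral_gaussDensity hs, mul_one]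
  simp [likelihoodMoment, fwdDiff_iter_eq_sum_shift]

lemma integrable_abs_likelihood_sub_one_pow {s : ℝ} (hs : 0 < s) (u : V) (k : ℕ) :
    Integrable fun x : V =>
      |gaussDensity u s x / gaussDensity 0 s x - 1| ^ k * gaussDensity 0 s x := by
  refine (integrable_likelihood_sub_one_pow hs u k).abs.congr (ae_of_all _ fun x => ?_)
  simp only [abs_mul, abs_pow, abs_of_pos (gaussDensity_pos hs 0 x)]

end Gaussian

lemma gaussND_eq_gaussDensity {p : ℕ} (μ : EuclideanSpace ℝ (Fin p)) (s : ℝ) :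
    gaussND μ s = gaussDensity μ s := by
  ext x
  simp [gaussND, gaussDensity]

lemma gauss1_eq_gaussDensity (μ s : ℝ) : gauss1 μ s = gaussDensity μ s := by
  ext x
  simp [gauss1, gaussDensity]

lemma Mcoef_eq_likelihoodMoment {r s : ℝ} (hr : 0 < r) (hs : 0 < s) (k : ℕ) :
    Mcoef (2 * s / r) k = likelihoodMoment (r ^ 2 / s ^ 2) k := by
  unfold Mcoef
  rw [show 2 * s / r / 2 = s / r by ring]
  simp only [gauss1_eq_gaussDensity]
  rw [integral_likelihood_sub_one_pow (by positivity)]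
  congr 1
  simp [div_pow]

section Bounds

variable {V : Type*} [NormedAddCommGroup V] [InnerProductSpace ℝ V] [FiniteDimensional ℝ V]
  [MeasurableSpace V] [BorelSpace V]

lemma integral_likelihood_sub_one_pow_le_Mcoef {r s : ℝ} (hr : 0 < r) (hs : 0 < s) {u : V}
    (hu : ‖u‖ ≤ r) (k : ℕ) :
    ∫ x : V, (gaussDensity u s x / gaussDensity 0 s x - 1) ^ k * gaussDensity 0 s x ≤
      Mcoef (2 * s / r) k := by
  rw [integral_likelihood_sub_one_pow hs, Mcoef_eq_likelihoodMoment hr hs]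
  exact likelihoodMoment_mono (by positivity) (by gcongr) k

lemma integral_abs_likelihood_sub_one_pow_le_Btil {r s : ℝ} (hr : 0 < r) (hs : 0 < s) {u : V}
    (hu : ‖u‖ ≤ r) (k : ℕ) :
    ∫ x : V, |gaussDensity u s x / gaussDensity 0 s x - 1| ^ k * gaussDensity 0 s x ≤
      Btil (2 * s / r) k := by
  unfold Btil
  split_ifs with hk
  · simp only [hk.pow_abs]
    exact integral_likelihood_sub_one_pow_le_Mcoef hr hs hu k
  · obtain ⟨m, rfl⟩ := Nat.not_even_iff_odd.1 hk
    rw [Nat.add_sub_cancel, show 2 * m + 1 + 1 = 2 * m + 2 by ring]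
    set A := Mcoef (2 * s / r) (2 * m)
    set B := Mcoef (2 * s / r) (2 * m + 2)
    set X := ∫ x : V, |gaussDensity u s x / gaussDensity 0 s x - 1| ^ (2 * m + 1) *
      gaussDensity 0 s x with hX
    refine Real.le_sqrt_of_sq_le ?_
    have hquad : ∀ t : ℝ, 0 ≤ A * (t * t) + (-2 * X) * t + B := by
      intro t
      have hA := integral_likelihood_sub_one_pow_le_Mcoef hr hs hu (2 * m)
      have hB := integral_likelihood_sub_one_pow_le_Mcoef hr hs hu (2 * m + 2)
      have hle : 2 * t * X ≤ t ^ 2 * (∫ x : V,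
          (gaussDensity u s x / gaussDensity 0 s x - 1) ^ (2 * m) * gaussDensity 0 s x) +
          ∫ x : V, (gaussDensity u s x / gaussDensity 0 s x - 1) ^ (2 * m + 2) *
            gaussDensity 0 s x := by
        rw [hX, ← integral_const_mul, ← integral_const_mul,
          ← integral_add ((integrable_likelihood_sub_one_pow hs u _).const_mul _)
            (integrable_likelihood_sub_one_pow hs u _)]
        refine integral_mono ((integrable_abs_likelihood_sub_one_pow hs u _).const_mul _)
          (((integrable_likelihood_sub_one_pow hs u _).const_mul _).add
            (integrable_likelihood_sub_one_pow hs u _)) fun x => ?_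
        have hg := (gaussDensity_pos hs 0 x).le
        simp only [← (even_two_mul m).pow_abs (gaussDensity u s x / gaussDensity 0 s x - 1),
          ← ((even_two_mul m).add even_two).pow_abs
            (gaussDensity u s x / gaussDensity 0 s x - 1)]
        set a := |gaussDensity u s x / gaussDensity 0 s x - 1|
        have h0 : 0 ≤ a ^ (2 * m) * (t - a) ^ 2 * gaussDensity 0 s x := by positivity
        linarith [show a ^ (2 * m) * (t - a) ^ 2 * gaussDensity 0 s x =
          t ^ 2 * (a ^ (2 * m) * gaussDensity 0 s x) + a ^ (2 * m + 2) * gaussDensity 0 s x -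
            2 * t * (a ^ (2 * m + 1) * gaussDensity 0 s x) by ring]
      nlinarith [mul_le_mul_of_nonneg_left hA (sq_nonneg t)]
    have hd := discrim_le_zero hquad
    unfold discrim at hd
    linarith

end Bounds

/-- Hölder-type product bound by `B̃_{σ,β₁+β₂}`. -/
theorem stmt12 {pd : ℕ} (r s : ℝ) (hr : 0 < r) (hs : 0 < s)
    (β₁ β₂ : ℝ) (hβ₁ : 0 < β₁) (hβ₂ : 0 < β₂)
    (κ : ℕ) (hκ : β₁ + β₂ = (κ : ℝ))
    (u v : EuclideanSpace ℝ (Fin pd)) (hu : ‖u‖ ≤ r) (hv : ‖v‖ ≤ r) :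
    ∫ θ : EuclideanSpace ℝ (Fin pd),
        |gaussND u s θ / gaussND 0 s θ - 1| ^ β₁ *
          |gaussND v s θ / gaussND 0 s θ - 1| ^ β₂ * gaussND 0 s θ ≤
      Btil (2 * s / r) κ := by
  simp only [gaussND_eq_gaussDensity]
  have hκ0 : (0 : ℝ) < κ := hκ ▸ add_pos hβ₁ hβ₂
  have hw : β₁ / κ + β₂ / κ = 1 := by rw [← add_div, hκ, div_self hκ0.ne']
  have hu' := integral_abs_likelihood_sub_one_pow_le_Btil hr hs hu κ
  have hv' := integral_abs_likelihood_sub_one_pow_le_Btil hr hs hv κ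
  have hiu := (integrable_abs_likelihood_sub_one_pow hs u κ).const_mul (β₁ / κ)
  have hiv := (integrable_abs_likelihood_sub_one_pow hs v κ).const_mul (β₂ / κ)
  have hrpow : ∀ a β : ℝ, 0 ≤ a → (a ^ κ) ^ (β / κ) = a ^ β := fun a β ha => by
    rw [← Real.rpow_natCast, ← Real.rpow_mul ha, mul_div_cancel₀ _ hκ0.ne']
  refine (integral_mono_of_nonneg (ae_of_all _ fun x => ?_) (hiu.add hiv)
    (ae_of_all _ fun x => ?_)).trans ?_
  · have hg := (gaussDensity_pos hs 0 x).le
    simp only [Pi.zero_apply]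
    positivity
  · have hg := (gaussDensity_pos hs 0 x).le
    have hamgm := Real.geom_mean_le_arith_mean2_weighted (div_pos hβ₁ hκ0).le
      (div_pos hβ₂ hκ0).le
      (pow_nonneg (abs_nonneg (gaussDensity u s x / gaussDensity 0 s x - 1)) κ)
      (pow_nonneg (abs_nonneg (gaussDensity v s x / gaussDensity 0 s x - 1)) κ) hw
    rw [hrpow _ _ (abs_nonneg _), hrpow _ _ (abs_nonneg _)] at hamgm
    simp only [Pi.add_apply, ← mul_assoc, ← add_mul]
    exact mul_le_mul_of_nonneg_right hamgm hg
  · simp only [Pi.add_apply]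
    rw [integral_add hiu hiv, integral_const_mul, integral_const_mul]
    calc _ ≤ β₁ / κ * Btil (2 * s / r) κ + β₂ / κ * Btil (2 * s / r) κ := by gcongr
      _ = Btil (2 * s / r) κ := by rw [← add_mul, hw, one_mul]
end
end

section
/- Let α > 1, σ > 0, 0 ≤ q < 1, and let m ≥ 1 be an integer. If α − m > 0 then | H_{α,σ}(q) − 1 − Σ_{k=2}^{m−1} (q^k/k!)·(∏_{j=0}^{k−1}(α−j))·M_{σ,k} | ≤ q^m·(∏_{j=0}^{m−1}|α−j|)·( Σ_{ℓ=0}^{⌈α⌉−m} q^ℓ·(⌈α⌉−m)!/((⌈α⌉−m−ℓ)!·(m+ℓ)!)·B̃_{σ,ℓ+m} + (1/m!)·B̃_{σ,m} ). If α − m ≤ 0 then | H_{α,σ}(q) − 1 − Σ_{k=2}^{m−1} (q^k/k!)·(∏_{j=0}^{k−1}(α−j))·M_{σ,k} | ≤ (q^m/m!)·(1−q)^{α−m}·(∏_{j=0}^{m−1}|α−j|)·B̃_{σ,m}. -/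
open MeasureTheory Finset

noncomputable section

/-- The remainder of the degree `m - 1` Taylor polynomial of `(1 + y) ^ a` at `y = 0`. -/
def binomRem (a : ℝ) (m : ℕ) (y : ℝ) : ℝ :=
  (1 + y) ^ a -
    ∑ k ∈ range m, (∏ j ∈ range k, (a - (j : ℝ))) / (k.factorial : ℝ) * y ^ k

/-- The `m`-fold antiderivative of `∑ ℓ < N, c ℓ / ℓ! * t ^ ℓ` vanishing to order `m` at `0`. -/
def binomMaj (N : ℕ) (c : ℕ → ℝ) (m : ℕ) (t : ℝ) : ℝ :=
  ∑ ℓ ∈ range N, c ℓ / ((m + ℓ).factorial : ℝ) * t ^ (m + ℓ)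

lemma hasDerivAt_binomMaj (N : ℕ) (c : ℕ → ℝ) (m : ℕ) (t : ℝ) :
    HasDerivAt (binomMaj N c (m + 1)) (binomMaj N c m t) t := by
  unfold binomMaj
  refine HasDerivAt.fun_sum fun ℓ _ => ?_
  have h := (hasDerivAt_pow (m + 1 + ℓ) t).const_mul (c ℓ / ((m + 1 + ℓ).factorial : ℝ))
  refine h.congr_deriv ?_
  have e : m + 1 + ℓ = (m + ℓ) + 1 := by ring
  rw [e, Nat.factorial_succ, Nat.add_sub_cancel]
  push_cast
  field_simp

lemma binomMaj_succ_zero (N : ℕ) (c : ℕ → ℝ) (m : ℕ) : binomMaj N c (m + 1) 0 = 0 := by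
  unfold binomMaj
  refine sum_eq_zero fun ℓ _ => ?_
  simp

lemma binomRem_succ_zero (a : ℝ) (m : ℕ) : binomRem a (m + 1) 0 = 0 := by
  simp [binomRem, sum_range_succ']

lemma hasDerivAt_binomRem (a : ℝ) (m : ℕ) {y : ℝ} (hy : 0 < 1 + y) :
    HasDerivAt (binomRem (a + 1) (m + 1)) ((a + 1) * binomRem a m y) y := by
  unfold binomRem
  have h1 : HasDerivAt (fun y : ℝ => (1 + y) ^ (a + 1)) ((a + 1) * (1 + y) ^ a) y := by
    have h := ((hasDerivAt_id y).const_add 1).rpow_const (p := a + 1) (Or.inl hy.ne')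
    simpa using h
  have h2 : HasDerivAt (fun y : ℝ => ∑ k ∈ range (m + 1),
      (∏ j ∈ range k, (a + 1 - (j : ℝ))) / (k.factorial : ℝ) * y ^ k)
      (∑ k ∈ range (m + 1),
        (∏ j ∈ range k, (a + 1 - (j : ℝ))) / (k.factorial : ℝ) * ((k : ℝ) * y ^ (k - 1))) y :=
    HasDerivAt.fun_sum fun k _ => (hasDerivAt_pow k y).const_mul _
  refine (h1.sub h2).congr_deriv (Eq.symm ?_)
  rw [mul_sub, sum_range_succ', mul_sum]
  simp only [Nat.cast_zero, zero_mul, mul_zero, add_zero]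
  congr 1
  refine sum_congr rfl fun k _ => ?_
  rw [prod_range_succ', Nat.factorial_succ, Nat.add_sub_cancel]
  have e : ∏ j ∈ range k, (a + 1 - ((j + 1 : ℕ) : ℝ)) = ∏ j ∈ range k, (a - (j : ℝ)) :=
    prod_congr rfl fun j _ => by push_cast; ring
  rw [e]
  push_cast
  field_simp
  ring

/-- If the `m`-th derivative of `(1 + y) ^ (b + m)` is dominated along a ray, then so is its
Taylor remainder. -/
lemma abs_binomRem_le {b e T : ℝ} (he : |e| = 1) (hpos : ∀ t ∈ Set.Icc 0 T, 0 < 1 + e * t)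
    {N : ℕ} {c : ℕ → ℝ} (hc : ∀ t ∈ Set.Icc 0 T, (1 + e * t) ^ b ≤ binomMaj N c 0 t) (m : ℕ) :
    ∀ t ∈ Set.Icc 0 T, |binomRem (b + m) m (e * t)| ≤
      (∏ j ∈ range m, |b + m - (j : ℝ)|) * binomMaj N c m t := by
  induction m with
  | zero =>
    intro t ht
    have h : |(1 + e * t) ^ b| ≤ binomMaj N c 0 t := by
      rw [abs_of_nonneg (Real.rpow_nonneg (hpos t ht).le _)]
      exact hc t ht
    simpa [binomRem] using h
  | succ m ih =>
    have hprod : ∏ j ∈ range (m + 1), |b + ((m + 1 : ℕ) : ℝ) - (j : ℝ)| =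
        |b + m + 1| * ∏ j ∈ range m, |b + m - (j : ℝ)| := by
      rw [prod_range_succ', mul_comm]
      congr 1
      · push_cast; ring_nf
      · refine prod_congr rfl fun j _ => ?_
        push_cast; ring_nf
    have hd : ∀ t ∈ Set.Icc 0 T, HasDerivAt (fun t => binomRem (b + m + 1) (m + 1) (e * t))
        ((b + m + 1) * binomRem (b + m) m (e * t) * e) t := by
      intro t ht
      have h1 := hasDerivAt_binomRem (b + m) m (hpos t ht)
      have h2 : HasDerivAt (fun t : ℝ => e * t) e t := by
        simpa using (hasDerivAt_id t).const_mul e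
      exact h1.comp t h2
    rw [hprod]
    have hcast : b + ((m + 1 : ℕ) : ℝ) = b + m + 1 := by push_cast; ring
    rw [hcast]
    refine image_norm_le_of_norm_deriv_right_le_deriv_boundary
      (f' := fun t => (b + m + 1) * binomRem (b + m) m (e * t) * e)
      (B' := fun t => |b + m + 1| * (∏ j ∈ range m, |b + m - (j : ℝ)|) * binomMaj N c m t)
      (fun t ht => (hd t ht).continuousAt.continuousWithinAt)
      (fun t ht => (hd t (Set.Ico_subset_Icc_self ht)).hasDerivWithinAt) ?_
      (fun t => (hasDerivAt_binomMaj N c m t).const_mul _) ?_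
    · simp [binomRem_succ_zero, binomMaj_succ_zero]
    · intro t ht
      rw [Real.norm_eq_abs, abs_mul, abs_mul, he, mul_one, mul_assoc]
      exact mul_le_mul_of_nonneg_left (ih t (Set.Ico_subset_Icc_self ht)) (abs_nonneg _)

lemma abs_binomRem_le_of_rpow_le {b e T C : ℝ} (he : |e| = 1)
    (hpos : ∀ t ∈ Set.Icc 0 T, 0 < 1 + e * t) (hC : ∀ t ∈ Set.Icc 0 T, (1 + e * t) ^ b ≤ C)
    (hT : 0 ≤ T) (m : ℕ) :
    |binomRem (b + m) m (e * T)| ≤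
      (∏ j ∈ range m, |b + m - (j : ℝ)|) * (C / (m.factorial : ℝ) * T ^ m) := by
  have h := abs_binomRem_le (N := 1) (c := fun _ => C) he hpos
    (fun t ht => by simpa [binomMaj] using hC t ht) m T ⟨hT, le_rfl⟩
  simpa [binomMaj] using h

lemma abs_binomRem_le_of_nonpos {b q y C : ℝ} (hq : q < 1) (hy : -q ≤ y) (hy0 : y ≤ 0)
    (hC : ∀ u, 1 - q ≤ u → u ≤ 1 → u ^ b ≤ C) (m : ℕ) :
    |binomRem (b + m) m y| ≤
      (∏ j ∈ range m, |b + m - (j : ℝ)|) * (C / (m.factorial : ℝ) * |y| ^ m) := by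
  have h := abs_binomRem_le_of_rpow_le (b := b) (e := -1) (T := -y) (C := C) (by simp)
    (fun t ht => by linarith [ht.2])
    (fun t ht => hC _ (by linarith [ht.2]) (by linarith [ht.1])) (by linarith) m
  rw [abs_of_nonpos hy0]
  simpa using h

lemma abs_binomRem_le_of_exponent_nonpos {b q y : ℝ} (hb : b ≤ 0) (hq0 : 0 ≤ q) (hq : q < 1)
    (hy : -q ≤ y) (m : ℕ) :
    |binomRem (b + m) m y| ≤
      (∏ j ∈ range m, |b + m - (j : ℝ)|) * ((1 - q) ^ b / (m.factorial : ℝ) * |y| ^ m) := by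
  rcases le_total y 0 with h0 | h0
  · exact abs_binomRem_le_of_nonpos hq hy h0
      (fun u hu _ => Real.rpow_le_rpow_of_nonpos (by linarith) hu hb) m
  · have h := abs_binomRem_le_of_rpow_le (b := b) (e := 1) (T := y) (C := (1 - q) ^ b) (by simp)
      (fun t ht => by linarith [ht.1])
      (fun t ht => Real.rpow_le_rpow_of_nonpos (by linarith) (by linarith [ht.1]) hb) h0 m
    rw [abs_of_nonneg h0]
    simpa using h

lemma abs_binomRem_le_of_exponent_nonneg {b q y : ℝ} {n : ℕ} (hb : 0 ≤ b) (hn : b ≤ n)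
    (hq : q < 1) (hy : -q ≤ y) (m : ℕ) :
    |binomRem (b + m) m y| ≤
      (∏ j ∈ range m, |b + m - (j : ℝ)|) *
        ((∑ ℓ ∈ range (n + 1), (n.factorial : ℝ) /
            (((n - ℓ).factorial : ℝ) * ((m + ℓ).factorial : ℝ)) * |y| ^ (ℓ + m)) +
          1 / (m.factorial : ℝ) * |y| ^ m) := by
  have hP : 0 ≤ ∏ j ∈ range m, |b + m - (j : ℝ)| := prod_nonneg fun _ _ => abs_nonneg _
  rcases le_total y 0 with h0 | h0
  · refine (abs_binomRem_le_of_nonpos hq hy h0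
      (fun u hu hu1 => Real.rpow_le_one (by linarith) hu1 hb) m).trans
      (mul_le_mul_of_nonneg_left ?_ hP)
    exact le_add_of_nonneg_left (sum_nonneg fun ℓ _ => by positivity)
  · have h := abs_binomRem_le (b := b) (e := 1) (T := y) (N := n + 1)
      (c := fun ℓ => (n.factorial : ℝ) / ((n - ℓ).factorial : ℝ)) (by simp)
      (fun t ht => by linarith [ht.1])
      (fun t ht => by
        have h1 : (1 + 1 * t) ^ b ≤ (1 + 1 * t) ^ (n : ℝ) :=
          Real.rpow_le_rpow_of_exponent_le (by linarith [ht.1]) hn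
        refine h1.trans_eq ?_
        rw [Real.rpow_natCast, one_mul, add_comm, add_pow, binomMaj]
        refine sum_congr rfl fun ℓ hℓ => ?_
        rw [Nat.cast_choose ℝ (Nat.lt_succ_iff.mp (mem_range.mp hℓ)), zero_add]
        field_simp
        simp) m y ⟨h0, le_rfl⟩
    rw [one_mul] at h
    refine h.trans (mul_le_mul_of_nonneg_left ?_ hP)
    rw [abs_of_nonneg h0, binomMaj]
    refine le_add_of_le_of_nonneg (le_of_eq (sum_congr rfl fun ℓ _ => ?_)) (by positivity)
    rw [add_comm ℓ m, div_div]

/-- Cauchy-Schwarz for absolute moments. -/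
lemma integral_abs_pow_odd_le {Ω : Type*} [MeasurableSpace Ω] {P : Measure Ω} {X : Ω → ℝ}
    (hX : AEStronglyMeasurable X P) (hpow : ∀ k : ℕ, Integrable (fun x => X x ^ k) P) (i : ℕ) :
    ∫ x, |X x| ^ (2 * i + 1) ∂P ≤
      Real.sqrt ((∫ x, X x ^ (2 * i) ∂P) * ∫ x, X x ^ (2 * i + 2) ∂P) := by
  have hL : ∀ k : ℕ, MemLp (fun x => |X x| ^ k) (ENNReal.ofReal 2) P := by
    intro k
    have hm : AEStronglyMeasurable (fun x => |X x| ^ k) P := hX.norm.pow k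
    have e : ENNReal.ofReal 2 = 2 := by simp
    rw [e, memLp_two_iff_integrable_sq hm]
    refine (hpow (2 * k)).congr (ae_of_all _ fun x => ?_)
    simp only [← pow_mul, mul_comm k 2]
    rw [pow_mul, pow_mul, sq_abs]
  have h := integral_mul_le_Lp_mul_Lq_of_nonneg (μ := P) Real.HolderConjugate.two_two
    (ae_of_all _ fun x => by positivity) (ae_of_all _ fun x => by positivity) (hL i) (hL (i + 1))
  have e1 : ∀ (k : ℕ) (x : Ω), (|X x| ^ k) ^ (2 : ℝ) = X x ^ (2 * k) := by
    intro k x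
    rw [Real.rpow_two, ← pow_mul, mul_comm k 2, pow_mul, pow_mul, sq_abs]
  have e2 : ∀ x, |X x| ^ i * |X x| ^ (i + 1) = |X x| ^ (2 * i + 1) := fun x => by ring
  have e3 : 2 * (i + 1) = 2 * i + 2 := by ring
  simp only [e1, e2, e3] at h
  rw [← Real.sqrt_eq_rpow, ← Real.sqrt_eq_rpow] at h
  rwa [Real.sqrt_mul (integral_nonneg fun x => by rw [pow_mul]; positivity)]

/-- Bounding the expected Taylor remainder by absolute moments of order `m + ℓ`. -/
lemma abs_integral_rpow_sub_taylor_le {Ω : Type*} [MeasurableSpace Ω] {P : Measure Ω}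
    {X : Ω → ℝ} (hX : Measurable X) (hpow : ∀ k : ℕ, Integrable (fun x => X x ^ k) P)
    {α q : ℝ} {m : ℕ} {g : Ω → ℝ} (hg : Integrable g P)
    (hle : ∀ x, |binomRem α m (q * X x)| ≤ g x) :
    |∫ x, (1 + q * X x) ^ α ∂P - ∑ k ∈ range m,
        q ^ k / (k.factorial : ℝ) * (∏ j ∈ range k, (α - (j : ℝ))) * ∫ x, X x ^ k ∂P| ≤
      ∫ x, g x ∂P := by
  have hmeas : Measurable fun x => binomRem α m (q * X x) := by
    unfold binomRem
    fun_prop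
  have hR : Integrable (fun x => binomRem α m (q * X x)) P :=
    hg.mono' hmeas.aestronglyMeasurable (ae_of_all _ hle)
  have hS : ∀ k ∈ range m, Integrable (fun x =>
      q ^ k / (k.factorial : ℝ) * (∏ j ∈ range k, (α - (j : ℝ))) * X x ^ k) P :=
    fun k _ => (hpow k).const_mul _
  have key : ∫ x, (1 + q * X x) ^ α ∂P - ∑ k ∈ range m,
        q ^ k / (k.factorial : ℝ) * (∏ j ∈ range k, (α - (j : ℝ))) * ∫ x, X x ^ k ∂P =
      ∫ x, binomRem α m (q * X x) ∂P := by
    have e : ∀ x, (1 + q * X x) ^ α = binomRem α m (q * X x) + ∑ k ∈ range m,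
        q ^ k / (k.factorial : ℝ) * (∏ j ∈ range k, (α - (j : ℝ))) * X x ^ k := by
      intro x
      rw [binomRem, sub_add, eq_comm, sub_eq_self, sub_eq_zero]
      refine sum_congr rfl fun k _ => ?_
      rw [mul_pow]
      ring
    simp_rw [e]
    rw [integral_add hR (integrable_finsetSum _ hS), integral_finsetSum _ hS]
    simp_rw [integral_const_mul]
    ring
  rw [key]
  exact (abs_integral_le_integral_abs).trans (integral_mono hR.abs hg hle)

lemma integrable_abs_pow {Ω : Type*} [MeasurableSpace Ω] {P : Measure Ω} {X : Ω → ℝ}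
    (hpow : ∀ k : ℕ, Integrable (fun x => X x ^ k) P) (k : ℕ) :
    Integrable (fun x => |X x| ^ k) P := by
  simpa [abs_pow] using (hpow k).abs

/-- The likelihood ratio of two unit-shifted Gaussians, minus one. -/
def gaussRatioSubOne (σ θ : ℝ) : ℝ := gauss1 1 (σ / 2) θ / gauss1 0 (σ / 2) θ - 1

lemma gauss1_eq_gaussianPDFReal (μ : ℝ) {s : ℝ} (θ : ℝ) :
    gauss1 μ s θ = ProbabilityTheory.gaussianPDFReal μ (s ^ 2).toNNReal θ := by
  rw [gauss1, ProbabilityTheory.gaussianPDFReal, Real.coe_toNNReal _ (sq_nonneg s),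
    Real.sqrt_eq_rpow, ← Real.rpow_neg (by positivity)]
  norm_num

lemma gauss1_pos (μ : ℝ) {s : ℝ} (hs : 0 < s) (θ : ℝ) : 0 < gauss1 μ s θ := by
  unfold gauss1
  positivity

lemma gaussRatioSubOne_eq {σ : ℝ} (hσ : 0 < σ) (θ : ℝ) :
    gaussRatioSubOne σ θ = Real.exp (4 / σ ^ 2 * θ) * Real.exp (-2 / σ ^ 2) - 1 := by
  have h : (2 * Real.pi * (σ / 2) ^ 2) ^ (-(1 : ℝ) / 2) ≠ 0 := by positivity
  rw [gaussRatioSubOne, gauss1, gauss1, mul_div_mul_left _ _ h, ← Real.exp_sub, ← Real.exp_add]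
  congr 2
  field_simp
  ring

lemma integral_mul_gauss1_zero {s : ℝ} (hs : 0 < s) (f : ℝ → ℝ) :
    ∫ θ, f θ * gauss1 0 s θ =
      ∫ θ, f θ ∂(ProbabilityTheory.gaussianReal 0 (s ^ 2).toNNReal) := by
  have hv : (s ^ 2).toNNReal ≠ 0 := (Real.toNNReal_pos.mpr (by positivity)).ne'
  rw [ProbabilityTheory.integral_gaussianReal_eq_integral_smul hv]
  simp_rw [gauss1_eq_gaussianPDFReal, smul_eq_mul, mul_comm]

lemma integrable_gaussRatioSubOne_pow {σ : ℝ} (hσ : 0 < σ) (k : ℕ) :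
    Integrable (fun θ => gaussRatioSubOne σ θ ^ k)
      (ProbabilityTheory.gaussianReal 0 ((σ / 2) ^ 2).toNNReal) := by
  simp_rw [gaussRatioSubOne_eq hσ, sub_eq_add_neg, add_pow]
  refine integrable_finsetSum _ fun i _ => ?_
  refine Integrable.mul_const (Integrable.mul_const ?_ _) _
  simp_rw [mul_pow, ← Real.exp_nat_mul, ← mul_assoc]
  exact (ProbabilityTheory.integrable_exp_mul_gaussianReal _).mul_const _

lemma Mcoef_eq {σ : ℝ} (hσ : 0 < σ) (k : ℕ) :
    Mcoef σ k = ∫ θ, gaussRatioSubOne σ θ ^ k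
      ∂(ProbabilityTheory.gaussianReal 0 ((σ / 2) ^ 2).toNNReal) :=
  integral_mul_gauss1_zero (half_pos hσ) _

lemma Hfun_eq {σ : ℝ} (hσ : 0 < σ) (α q : ℝ) :
    Hfun α σ q = ∫ θ, (1 + q * gaussRatioSubOne σ θ) ^ α
      ∂(ProbabilityTheory.gaussianReal 0 ((σ / 2) ^ 2).toNNReal) := by
  rw [← integral_mul_gauss1_zero (half_pos hσ), Hfun]
  congr 1
  ext θ
  rw [gaussRatioSubOne]
  ring_nf

lemma Mcoef_zero {σ : ℝ} (hσ : 0 < σ) : Mcoef σ 0 = 1 := by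
  simp [Mcoef_eq hσ]

lemma Mcoef_one {σ : ℝ} (hσ : 0 < σ) : Mcoef σ 1 = 0 := by
  have hv : ((σ / 2) ^ 2).toNNReal ≠ 0 := (Real.toNNReal_pos.mpr (by positivity)).ne'
  have e : ∀ θ : ℝ, (gauss1 1 (σ / 2) θ / gauss1 0 (σ / 2) θ - 1) ^ 1 * gauss1 0 (σ / 2) θ =
      ProbabilityTheory.gaussianPDFReal 1 ((σ / 2) ^ 2).toNNReal θ -
        ProbabilityTheory.gaussianPDFReal 0 ((σ / 2) ^ 2).toNNReal θ := by
    intro θ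
    have h := (gauss1_pos 0 (half_pos hσ) θ).ne'
    rw [← gauss1_eq_gaussianPDFReal, ← gauss1_eq_gaussianPDFReal]
    field_simp
  rw [Mcoef]
  simp_rw [e]
  rw [integral_sub (ProbabilityTheory.integrable_gaussianPDFReal _ _)
    (ProbabilityTheory.integrable_gaussianPDFReal _ _),
    ProbabilityTheory.integral_gaussianPDFReal_eq_one _ hv,
    ProbabilityTheory.integral_gaussianPDFReal_eq_one _ hv, sub_self]

lemma measurable_gaussRatioSubOne (σ : ℝ) : Measurable (gaussRatioSubOne σ) := by
  unfold gaussRatioSubOne gauss1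
  fun_prop

lemma neg_one_le_gaussRatioSubOne {σ : ℝ} (hσ : 0 < σ) (θ : ℝ) : -1 ≤ gaussRatioSubOne σ θ := by
  rw [gaussRatioSubOne_eq hσ]
  have h : 0 ≤ Real.exp (4 / σ ^ 2 * θ) * Real.exp (-2 / σ ^ 2) := by positivity
  linarith

lemma integral_abs_gaussRatioSubOne_pow_le_Btil {σ : ℝ} (hσ : 0 < σ) (j : ℕ) :
    ∫ θ, |gaussRatioSubOne σ θ| ^ j
      ∂(ProbabilityTheory.gaussianReal 0 ((σ / 2) ^ 2).toNNReal) ≤ Btil σ j := by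
  unfold Btil
  split_ifs with h
  · rw [Mcoef_eq hσ]
    simp_rw [h.pow_abs]
    exact le_rfl
  · obtain ⟨i, rfl⟩ := Nat.not_even_iff_odd.mp h
    rw [Mcoef_eq hσ, Mcoef_eq hσ]
    exact integral_abs_pow_odd_le (measurable_gaussRatioSubOne σ).aestronglyMeasurable
      (integrable_gaussRatioSubOne_pow hσ) i

lemma one_add_sum_Icc_two_eq_sum_range {m : ℕ} (hm : 1 ≤ m) {σ : ℝ} (hσ : 0 < σ) (α q : ℝ) :
    1 + ∑ k ∈ Icc 2 (m - 1),
        q ^ k / (k.factorial : ℝ) * (∏ j ∈ range k, (α - (j : ℝ))) * Mcoef σ k =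
      ∑ k ∈ range m,
        q ^ k / (k.factorial : ℝ) * (∏ j ∈ range k, (α - (j : ℝ))) * Mcoef σ k := by
  have e : Icc 2 (m - 1) = Ico 2 m := by
    ext k
    simp only [mem_Icc, mem_Ico]
    omega
  rw [e, range_eq_Ico, sum_eq_sum_Ico_succ_bot (by omega : 0 < m)]
  rcases hm.eq_or_lt with rfl | h
  · simp [Mcoef_zero hσ]
  · rw [sum_eq_sum_Ico_succ_bot (by omega : 0 + 1 < m)]
    simp [Mcoef_zero hσ, Mcoef_one hσ]

/-- order-`m` Taylor expansion bound for `H_{α,σ}` with remainder estimates. -/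
theorem stmt14 (α σ q : ℝ) (m : ℕ) (hα : 1 < α) (hσ : 0 < σ)
    (hq0 : 0 ≤ q) (hq1 : q < 1) (hm : 1 ≤ m) :
    ((m : ℝ) < α →
      |Hfun α σ q - 1 - ∑ k ∈ Finset.Icc 2 (m - 1),
          q ^ k / (k.factorial : ℝ) * (∏ j ∈ Finset.range k, (α - (j : ℝ))) * Mcoef σ k| ≤
        q ^ m * (∏ j ∈ Finset.range m, |α - (j : ℝ)|) *
          ((∑ ℓ ∈ Finset.range (⌈α⌉₊ - m + 1),
              q ^ ℓ * ((⌈α⌉₊ - m).factorial : ℝ) /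
                (((⌈α⌉₊ - m - ℓ).factorial : ℝ) * ((m + ℓ).factorial : ℝ)) * Btil σ (ℓ + m)) +
            1 / (m.factorial : ℝ) * Btil σ m)) ∧
    (α ≤ (m : ℝ) →
      |Hfun α σ q - 1 - ∑ k ∈ Finset.Icc 2 (m - 1),
          q ^ k / (k.factorial : ℝ) * (∏ j ∈ Finset.range k, (α - (j : ℝ))) * Mcoef σ k| ≤
        q ^ m / (m.factorial : ℝ) * (1 - q) ^ (α - (m : ℝ)) *
          (∏ j ∈ Finset.range m, |α - (j : ℝ)|) * Btil σ m) := by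
  have hpow := integrable_gaussRatioSubOne_pow hσ
  have habs := integrable_abs_pow hpow
  have hX := measurable_gaussRatioSubOne σ
  have hB := integral_abs_gaussRatioSubOne_pow_le_Btil hσ
  have hy : ∀ θ, -q ≤ q * gaussRatioSubOne σ θ := fun θ => by
    nlinarith [neg_one_le_gaussRatioSubOne hσ θ]
  have hP : 0 ≤ ∏ j ∈ range m, |α - (j : ℝ)| := prod_nonneg fun _ _ => abs_nonneg _
  have hαm : α - m + m = α := by ring
  rw [sub_sub, one_add_sum_Icc_two_eq_sum_range hm hσ, Hfun_eq hσ]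
  simp_rw [Mcoef_eq hσ]
  constructor
  · intro h
    have hmc : m ≤ ⌈α⌉₊ := by exact_mod_cast h.le.trans (Nat.le_ceil α)
    have hn : α - m ≤ ((⌈α⌉₊ - m : ℕ) : ℝ) := by
      rw [Nat.cast_sub hmc]
      linarith [Nat.le_ceil α]
    have hle := fun θ => abs_binomRem_le_of_exponent_nonneg (sub_nonneg.mpr h.le) hn hq1 (hy θ) m
    simp only [hαm, abs_mul, abs_of_nonneg hq0, mul_pow] at hle
    have hi : ∀ ℓ ∈ range (⌈α⌉₊ - m + 1), Integrable (fun θ =>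
        ((⌈α⌉₊ - m).factorial : ℝ) / (((⌈α⌉₊ - m - ℓ).factorial : ℝ) * ((m + ℓ).factorial : ℝ)) *
          (q ^ (ℓ + m) * |gaussRatioSubOne σ θ| ^ (ℓ + m)))
        (ProbabilityTheory.gaussianReal 0 ((σ / 2) ^ 2).toNNReal) :=
      fun ℓ _ => ((habs _).const_mul _).const_mul _
    have hi' := integrable_finsetSum _ hi
    have hi'' := ((habs m).const_mul (q ^ m)).const_mul (1 / (m.factorial : ℝ))
    refine (abs_integral_rpow_sub_taylor_le hX hpow ((hi'.add hi'').const_mul _) hle).trans ?_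
    rw [integral_const_mul, mul_comm (q ^ m), mul_assoc]
    refine mul_le_mul_of_nonneg_left ?_ hP
    simp only [Pi.add_apply]
    rw [integral_add hi' hi'', integral_finsetSum _ hi, mul_add, mul_sum]
    simp_rw [integral_const_mul]
    refine add_le_add (sum_le_sum fun ℓ _ => ?_) ?_
    · refine (mul_le_mul_of_nonneg_left (mul_le_mul_of_nonneg_left (hB (ℓ + m))
        (by positivity)) (by positivity)).trans_eq ?_
      ring
    · refine (mul_le_mul_of_nonneg_left (mul_le_mul_of_nonneg_left (hB m)
        (by positivity)) (by positivity)).trans_eq ?_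
      ring
  · intro h
    have hle := fun θ =>
      abs_binomRem_le_of_exponent_nonpos (sub_nonpos.mpr h) hq0 hq1 (hy θ) m
    simp only [hαm, abs_mul, abs_of_nonneg hq0, mul_pow] at hle
    refine (abs_integral_rpow_sub_taylor_le hX hpow
      ((((habs m).const_mul _).const_mul _).const_mul _) hle).trans ?_
    simp_rw [integral_const_mul]
    have hq : 0 ≤ (1 - q) ^ (α - (m : ℝ)) := Real.rpow_nonneg (by linarith) _
    refine (mul_le_mul_of_nonneg_left (mul_le_mul_of_nonneg_left (mul_le_mul_of_nonneg_left (hB m)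
        (by positivity)) (by positivity)) hP).trans_eq ?_
    ring
end
end
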